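/- If the angles (ω_w), indexed by all finite words w over {0,1,2,3}, are i.i.d. uniform on [0, π/2], then almost surely liminf_{n→∞} n · Fav(𝒟_n(ω)) < ∞, where 𝒟_n(ω) is built from the angles indexed by words of length < n. -/

import Mathlib

open MeasureTheory Real Set
open scoped ENNReal

noncomputable section

/-- The uniform probability measure on the interval `[0, π/2]`. -/
def unif : Measure ℝ := (ENNReal.ofReal (π / 2))⁻¹ • volume.restrict (Set.Icc 0 (π / 2))

/-- An infinite angle tree: an angle for every finite word over `{0,1,2,3}`. -/
abbrev InfAngleTree := List (Fin 4) → ℝ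

/-- The centre `c(ω, w)` of the disk indexed by the word `w` of length `n`, built from an
infinite angle tree `ω` (only the angles at the proper prefixes of `w` are used). -/
def center (ω : InfAngleTree) {n : ℕ} (w : Fin n → Fin 4) : ℂ :=
  ∑ k : Fin n, (3 / 4 : ℂ) * (4 : ℂ)⁻¹ ^ (k : ℕ) *
    Complex.exp (((((w k : ℕ) : ℝ) * (π / 2) -
      ω (List.ofFn fun i : Fin k => w (Fin.castLE k.isLt.le i)) : ℝ) : ℂ) * Complex.I)

/-- The `n`-th generation random Cantor disks `𝒟_n(ω)`, built from the angles of `ω`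
indexed by words of length `< n`. -/
def cantorDisks (n : ℕ) (ω : InfAngleTree) : Set ℂ :=
  ⋃ w : Fin n → Fin 4, Metric.closedBall (center ω w) ((4 : ℝ)⁻¹ ^ n)

/-- The orthogonal projection of `E ⊆ ℂ` onto the line `ℝ·e^{iθ}`, identified with `ℝ`. -/
def proj (θ : ℝ) (E : Set ℂ) : Set ℝ :=
  (fun z => (Complex.exp (-(θ : ℂ) * Complex.I) * z).re) '' E

/-- The Favard length `Fav(E) = (1/π) ∫_0^π |proj_θ E| dθ`, valued in `ℝ≥0∞`. -/
def favLength (E : Set ℂ) : ℝ≥0∞ :=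
  ENNReal.ofReal (1 / π) * ∫⁻ θ in Set.Ioo (0 : ℝ) π, volume (proj θ E)

lemma lintegral_le_lintegral_comp_mul_cos {K : ℝ → ℝ≥0∞} {c : ℝ} (hc : 0 < c)
    (hK : ∀ s, c < |s| → K s = 0) :
    ∫⁻ s, K s ≤ ENNReal.ofReal c * ∫⁻ ψ in Icc 0 π, K (c * cos ψ) := by
  have himg : ∀ s, K s ≠ 0 → s ∈ (fun ψ => c * cos ψ) '' Icc 0 π := by
    intro s hs
    have hsc : |s| ≤ c := by
      by_contra! h
      exact hs (hK s h)
    have hs1 : s / c ∈ Icc (-1 : ℝ) 1 := by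
      rw [abs_le] at hsc
      constructor
      · rw [le_div_iff₀ hc]; linarith
      · rw [div_le_iff₀ hc]; linarith
    obtain ⟨ψ, hψ, h⟩ := Real.bijOn_cos.surjOn hs1
    refine ⟨ψ, hψ, ?_⟩
    simp only [h]
    field_simp
  have hderiv : ∀ ψ ∈ Icc (0 : ℝ) π,
      HasDerivWithinAt (fun ψ => c * cos ψ) (c * -sin ψ) (Icc 0 π) ψ := fun ψ _ =>
    ((Real.hasDerivAt_cos ψ).const_mul c).hasDerivWithinAt
  have hinj : InjOn (fun ψ => c * cos ψ) (Icc 0 π) := fun a ha b hb h =>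
    Real.injOn_cos ha hb (mul_left_cancel₀ hc.ne' h)
  calc ∫⁻ s, K s = ∫⁻ s in (fun ψ => c * cos ψ) '' Icc 0 π, K s := by
        rw [setLIntegral_eq_of_support_subset]
        exact himg
    _ = ∫⁻ ψ in Icc 0 π, ENNReal.ofReal |c * -sin ψ| * K (c * cos ψ) :=
        lintegral_image_eq_lintegral_abs_deriv_mul measurableSet_Icc hderiv hinj K
    _ ≤ ∫⁻ ψ in Icc 0 π, ENNReal.ofReal c * K (c * cos ψ) := by
        gcongr with ψ
        rw [abs_mul, abs_neg, abs_of_pos hc]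
        exact mul_le_of_le_one_right hc.le (abs_sin_le_one ψ)
    _ = ENNReal.ofReal c * ∫⁻ ψ in Icc 0 π, K (c * cos ψ) :=
        lintegral_const_mul' _ _ ENNReal.ofReal_ne_top

lemma setLIntegral_Ioc_eq_of_periodic {G : ℝ → ℝ≥0∞} {T : ℝ} (hT : 0 < T)
    (hG : Function.Periodic G T) (s t : ℝ) :
    ∫⁻ x in Ioc s (s + T), G x = ∫⁻ x in Ioc t (t + T), G x := by
  refine IsAddFundamentalDomain.setLIntegral_eq (G := AddSubgroup.zmultiples T)
    (isAddFundamentalDomain_Ioc hT s) (isAddFundamentalDomain_Ioc hT t) G ?_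
  exact hG.map_vadd_zmultiples

lemma setLIntegral_Icc_comp_sub_left (G : ℝ → ℝ≥0∞) (a b : ℝ) :
    ∫⁻ x in Icc 0 b, G (a - x) = ∫⁻ x in Ioc (a - b) a, G x := by
  have h := (Measure.measurePreserving_sub_left (volume : Measure ℝ) a).setLIntegral_comp_preimage_emb
    (measurableEmbedding_subLeft a) G (Icc (a - b) a)
  rw [restrict_Ioc_eq_restrict_Icc, ← h]
  congr 2
  simp

lemma sum_setLIntegral_quarter {G : ℝ → ℝ≥0∞} (hG : Function.Periodic G (2 * π)) (β : ℝ) :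
    ∑ j : Fin 4, ∫⁻ φ in Icc 0 (π / 2), G (((j : ℕ) : ℝ) * (π / 2) - φ - β) =
      ∫⁻ ψ in Ioc 0 (2 * π), G ψ := by
  have hπ := Real.pi_pos
  have hj : ∀ (j : Fin 4) (a b : ℝ), a = ((j : ℕ) : ℝ) * (π / 2) - β - π / 2 →
      b = ((j : ℕ) : ℝ) * (π / 2) - β →
      ∫⁻ φ in Icc 0 (π / 2), G (((j : ℕ) : ℝ) * (π / 2) - φ - β) = ∫⁻ ψ in Ioc a b, G ψ := by
    rintro j a b rfl rfl
    rw [← setLIntegral_Icc_comp_sub_left]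
    simp only [sub_right_comm]
  have hunion : ∀ a b c : ℝ, a ≤ b → b ≤ c →
      (∫⁻ x in Ioc a b, G x) + ∫⁻ x in Ioc b c, G x = ∫⁻ x in Ioc a c, G x := by
    intro a b c hab hbc
    rw [← Ioc_union_Ioc_eq_Ioc hab hbc, lintegral_union measurableSet_Ioc]
    exact Ioc_disjoint_Ioc_of_le (le_refl b)
  have h := setLIntegral_Ioc_eq_of_periodic (by positivity) hG 0 (-β - π / 2)
  rw [zero_add] at h
  have e3 : (((3 : Fin 4) : ℕ) : ℝ) = 3 := by norm_num
  rw [h, Fin.sum_univ_four, hj 0 (-β - π / 2) (-β) (by simp) (by simp),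
    hj 1 (-β) (-β + π / 2) (by simp) (by simp; ring),
    hj 2 (-β + π / 2) (-β + 2 * (π / 2)) (by simp; ring) (by simp; ring),
    hj 3 (-β + 2 * (π / 2)) (-β - π / 2 + 2 * π) (by rw [e3]; ring) (by rw [e3]; ring),
    hunion _ _ _ (by linarith) (by linarith), hunion _ _ _ (by linarith) (by linarith),
    hunion _ _ _ (by linarith) (by linarith)]

lemma lintegral_lintegral_mul_add {f : ℝ → ℝ≥0∞} (hf : Measurable f) :
    ∫⁻ s, ∫⁻ y, f y * f (y + s) = (∫⁻ y, f y) ^ 2 := by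
  rw [lintegral_lintegral_swap (by fun_prop)]
  have h : ∀ y, ∫⁻ s, f y * f (y + s) = f y * ∫⁻ y, f y := by
    intro y
    rw [lintegral_const_mul _ (by fun_prop), lintegral_add_left_eq_self]
  simp_rw [h]
  rw [lintegral_mul_const _ hf, sq]

lemma lintegral_comp_four_mul_sub {f : ℝ → ℝ≥0∞} (hf : Measurable f) (b : ℝ) :
    ∫⁻ x, f (4 * x - b) = 4⁻¹ * ∫⁻ y, f y := by
  have h := lintegral_map (μ := volume) (f := fun y => f (y - b)) (g := fun x : ℝ => 4 * x)
    (by fun_prop) (by fun_prop)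
  rw [Real.map_volume_mul_left (by norm_num), lintegral_smul_measure,
    lintegral_sub_right_eq_self] at h
  rw [← h]
  simp [abs_of_pos, ENNReal.ofReal_inv_of_pos]

/-- The autocorrelation of a function on the line. -/
def autocorr (f : ℝ → ℝ≥0∞) (s : ℝ) : ℝ≥0∞ := ∫⁻ y, f y * f (y + s)

lemma measurable_autocorr {f : ℝ → ℝ≥0∞} (hf : Measurable f) : Measurable (autocorr f) := by
  unfold autocorr
  fun_prop

lemma autocorr_eq_zero {f : ℝ → ℝ≥0∞} (hf : ∀ x, 1 < |x| → f x = 0) {s : ℝ} (hs : 2 < |s|) :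
    autocorr f s = 0 := by
  unfold autocorr
  rw [← lintegral_zero (μ := (volume : Measure ℝ))]
  congr 1
  ext y
  by_cases hy : 1 < |y|
  · rw [hf y hy, zero_mul]
  · rw [hf (y + s), mul_zero]
    have : |s| ≤ |y + s| + |y| := by
      simpa using abs_sub (y + s) y
    linarith

lemma sq_lintegral_le_sum_autocorr {f : ℝ → ℝ≥0∞} (hf : Measurable f)
    (hsupp : ∀ x, 1 < |x| → f x = 0) (θ : ℝ) :
    (∫⁻ y, f y) ^ 2 ≤ ENNReal.ofReal (3 * √2) *
      ∑ j : Fin 4, ∫⁻ φ in Icc 0 (π / 2),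
        autocorr f (3 * (cos (((j : ℕ) : ℝ) * (π / 2) - φ - θ) +
          sin (((j : ℕ) : ℝ) * (π / 2) - φ - θ))) := by
  have hs2 : (1 : ℝ) ≤ √2 := Real.one_le_sqrt.2 (by norm_num)
  have h1 := lintegral_le_lintegral_comp_mul_cos (K := autocorr f) (c := 3 * √2) (by positivity)
    (fun s hs => autocorr_eq_zero hsupp (by linarith))
  have hper : Function.Periodic (fun ψ => autocorr f (3 * √2 * cos ψ)) (2 * π) := fun ψ => by
    simp
  have h2 := sum_setLIntegral_quarter hper (θ + π / 4)
  have htrig : ∀ u, 3 * (cos u + sin u) = 3 * √2 * cos (u - π / 4) := by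
    intro u
    rw [cos_sub, cos_pi_div_four, sin_pi_div_four]
    have := Real.mul_self_sqrt (show (0 : ℝ) ≤ 2 by norm_num)
    linear_combination (-3 / 2 * (cos u + sin u)) * this
  simp_rw [htrig]
  simp_rw [← sub_sub] at h2
  rw [h2, ← lintegral_lintegral_mul_add hf]
  refine h1.trans ?_
  refine mul_le_mul' le_rfl ?_
  rw [restrict_Ioc_eq_restrict_Icc]
  exact lintegral_mono_set (Icc_subset_Icc le_rfl (by linarith [Real.pi_pos]))

lemma cos_add_one_quarter (j : Fin 4) (t : ℝ) :
    cos ((((j + 1 : Fin 4) : ℕ) : ℝ) * (π / 2) - t) = -sin (((j : ℕ) : ℝ) * (π / 2) - t) := by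
  have h : (((j + 1 : Fin 4) : ℕ) : ℝ) * (π / 2) - t = ((j : ℕ) : ℝ) * (π / 2) - t + π / 2 ∨
      (((j + 1 : Fin 4) : ℕ) : ℝ) * (π / 2) - t =
        ((j : ℕ) : ℝ) * (π / 2) - t + π / 2 - 2 * π := by
    by_cases hj : j = 3
    · right
      subst hj
      norm_num
      ring
    · left
      have h1 : ((j + 1 : Fin 4) : ℕ) = j + 1 := by
        revert hj
        revert j
        decide
      rw [h1]
      push_cast
      ring
  rcases h with h | h
  · rw [h, cos_add_pi_div_two]
  · rw [h, cos_sub_two_pi, cos_add_pi_div_two]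

/-- The coordinate, along the direction `θ`, of the `j`-th vertex of the square rotated by `-φ`. -/
def vertexCoord (θ φ : ℝ) (j : Fin 4) : ℝ := cos (((j : ℕ) : ℝ) * (π / 2) - φ - θ)

lemma lintegral_mul_vertexCoord {f : ℝ → ℝ≥0∞} (hf : Measurable f) (θ φ : ℝ) (j : Fin 4) :
    ∫⁻ x, f (4 * x - 3 * vertexCoord θ φ j) * f (4 * x - 3 * vertexCoord θ φ (j + 1)) =
      4⁻¹ * autocorr f (3 * (cos (((j : ℕ) : ℝ) * (π / 2) - φ - θ) +
          sin (((j : ℕ) : ℝ) * (π / 2) - φ - θ))) := by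
  have h : vertexCoord θ φ (j + 1) = -sin (((j : ℕ) : ℝ) * (π / 2) - φ - θ) := by
    unfold vertexCoord
    rw [sub_sub, cos_add_one_quarter, sub_sub]
  unfold autocorr
  rw [h, ← lintegral_comp_four_mul_sub (by fun_prop) (3 * vertexCoord θ φ j)]
  unfold vertexCoord
  congr! 4
  ring

instance : IsProbabilityMeasure unif := by
  constructor
  have hπ : 0 < π / 2 := by positivity
  simp only [unif, Measure.smul_apply, Measure.restrict_apply_univ, Real.volume_Icc, sub_zero,
    smul_eq_mul]
  exact ENNReal.inv_mul_cancel (by simpa using hπ) ENNReal.ofReal_ne_top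

lemma lintegral_add_sq_div_le_of_step {f g : ℝ → ℝ≥0∞} (hf : Measurable f) (hg : Measurable g)
    (hsupp : ∀ x, 1 < |x| → f x = 0) (θ : ℝ)
    (hstep : ∀ x, 4 * g x + ∫⁻ φ, ∑ j, f (4 * x - 3 * vertexCoord θ φ j) *
        f (4 * x - 3 * vertexCoord θ φ (j + 1)) ∂unif ≤
      4 * ∫⁻ φ, ∑ j, f (4 * x - 3 * vertexCoord θ φ j) ∂unif) :
    (∫⁻ x, g x) + (∫⁻ x, f x) ^ 2 / 200 ≤ ∫⁻ x, f x := by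
  have hv : ∀ j, Measurable fun φ => vertexCoord θ φ j := by
    intro j
    unfold vertexCoord
    fun_prop
  set L := ∫⁻ x, f x with hL
  have hfirst : ∫⁻ x, ∫⁻ φ, ∑ j, f (4 * x - 3 * vertexCoord θ φ j) ∂unif = L := by
    rw [lintegral_lintegral_swap (by fun_prop)]
    have : ∀ φ, ∫⁻ x, ∑ j, f (4 * x - 3 * vertexCoord θ φ j) = L := by
      intro φ
      rw [lintegral_finsetSum _ (by fun_prop)]
      simp_rw [lintegral_comp_four_mul_sub hf]
      rw [← hL, Finset.sum_const, Finset.card_univ, Fintype.card_fin, nsmul_eq_mul, ← mul_assoc]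
      norm_num [ENNReal.mul_inv_cancel]
    simp [this]
  have hsecond : L ^ 2 / 50 ≤ ∫⁻ x, ∫⁻ φ, ∑ j, f (4 * x - 3 * vertexCoord θ φ j) *
      f (4 * x - 3 * vertexCoord θ φ (j + 1)) ∂unif := by
    rw [lintegral_lintegral_swap (by fun_prop)]
    have hK := measurable_autocorr hf
    have hinner : ∀ φ, ∫⁻ x, ∑ j, f (4 * x - 3 * vertexCoord θ φ j) *
        f (4 * x - 3 * vertexCoord θ φ (j + 1)) =
        ∑ j : Fin 4, 4⁻¹ * autocorr f (3 * (cos (((j : ℕ) : ℝ) * (π / 2) - φ - θ) +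
          sin (((j : ℕ) : ℝ) * (π / 2) - φ - θ))) := by
      intro φ
      rw [lintegral_finsetSum _ (by fun_prop)]
      simp_rw [lintegral_mul_vertexCoord hf]
    simp_rw [hinner]
    rw [lintegral_finsetSum _ (by fun_prop)]
    simp_rw [lintegral_const_mul' _ _ (show (4 : ℝ≥0∞)⁻¹ ≠ ⊤ by simp)]
    simp_rw [unif, lintegral_smul_measure, smul_eq_mul, ← Finset.mul_sum]
    have h := sq_lintegral_le_sum_autocorr hf hsupp θ
    rw [← hL] at h
    set S := ∑ j : Fin 4, ∫⁻ φ in Icc 0 (π / 2),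
        autocorr f (3 * (cos (((j : ℕ) : ℝ) * (π / 2) - φ - θ) +
          sin (((j : ℕ) : ℝ) * (π / 2) - φ - θ)))
    have hs : √2 ≤ 1.5 := by
      rw [Real.sqrt_le_left (by norm_num)]; norm_num
    have hc : ENNReal.ofReal (3 * √2) ≤ 50 * (4⁻¹ * (ENNReal.ofReal (π / 2))⁻¹) := by
      rw [← ENNReal.ofReal_inv_of_pos (by positivity),
        show (50 : ℝ≥0∞) = ENNReal.ofReal 50 by simp,
        show (4 : ℝ≥0∞)⁻¹ = ENNReal.ofReal (4⁻¹) by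
          rw [ENNReal.ofReal_inv_of_pos (by norm_num)]; simp,
        ← ENNReal.ofReal_mul (by norm_num), ← ENNReal.ofReal_mul (by norm_num)]
      apply ENNReal.ofReal_le_ofReal
      have : (2 : ℝ) / 4 ≤ (π / 2)⁻¹ := by
        rw [inv_div]
        exact div_le_div_of_nonneg_left (by norm_num) Real.pi_pos Real.pi_le_four
      linarith
    rw [ENNReal.div_le_iff_le_mul (by simp) (by simp)]
    calc L ^ 2 ≤ ENNReal.ofReal (3 * √2) * S := h
      _ ≤ 50 * (4⁻¹ * (ENNReal.ofReal (π / 2))⁻¹) * S := by gcongr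
      _ = _ := by ring
  have hint : 4 * (∫⁻ x, g x) + L ^ 2 / 50 ≤ 4 * L := by
    calc 4 * (∫⁻ x, g x) + L ^ 2 / 50 ≤ _ := add_le_add_right hsecond _
      _ = ∫⁻ x, (4 * g x + ∫⁻ φ, ∑ j, f (4 * x - 3 * vertexCoord θ φ j) *
        f (4 * x - 3 * vertexCoord θ φ (j + 1)) ∂unif) := by
          rw [lintegral_add_left (by fun_prop), lintegral_const_mul _ hg]
      _ ≤ ∫⁻ x, 4 * ∫⁻ φ, ∑ j, f (4 * x - 3 * vertexCoord θ φ j) ∂unif := lintegral_mono hstep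
      _ = 4 * L := by
          rw [lintegral_const_mul' _ _ (by simp), hfirst]
  have h4 : L ^ 2 / 50 = 4 * (L ^ 2 / 200) := by
    rw [div_eq_mul_inv, div_eq_mul_inv, mul_left_comm]
    congr 1
    rw [show (200 : ℝ≥0∞) = 4 * 50 by norm_num, ENNReal.mul_inv (by simp) (by simp), ← mul_assoc,
      ENNReal.mul_inv_cancel (by simp) (by simp), one_mul]
  rw [h4, ← mul_add] at hint
  exact (ENNReal.mul_le_mul_iff_right (by simp) (by simp)).1 hint

/-- The angle tree with angle `φ` at the root and subtrees `t 0, …, t 3` below it. -/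
def graft (p : ℝ × (Fin 4 → InfAngleTree)) : InfAngleTree
  | [] => p.1
  | j :: w => p.2 j w

lemma measurable_graft : Measurable graft := by
  refine measurable_pi_lambda _ fun w => ?_
  cases w with
  | nil => exact measurable_fst
  | cons j w => simp only [graft]; fun_prop

lemma prod_list_eq_prod_nil_mul_prod_cons {M α : Type*} [CommMonoid M] [Fintype α]
    [DecidableEq α] (s : Finset (List α)) (u : List α → M) :
    ∏ w ∈ s, u w = (if [] ∈ s then u [] else 1) *
      ∏ j, ∏ w ∈ s.preimage (List.cons j) (List.cons_injective.injOn), u (j :: w) := by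
  rw [← Finset.prod_fiberwise s List.head? u, Fintype.prod_option]
  congr 1
  · simp only [List.head?_eq_none_iff]
    rw [Finset.prod_filter, Finset.prod_ite_eq']
  · refine Finset.prod_congr rfl fun j _ => ?_
    classical
    rw [Finset.prod_preimage']
    refine Finset.prod_congr (Finset.filter_congr fun w _ => ?_) fun _ _ => rfl
    cases w <;> simp [eq_comm]

lemma map_graft_infinitePi_unif :
    (unif.prod (Measure.pi fun _ : Fin 4 => Measure.infinitePi fun _ : List (Fin 4) => unif)).map
      graft = Measure.infinitePi fun _ : List (Fin 4) => unif := by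
  refine Measure.eq_infinitePi _ fun s t ht => ?_
  have hpre : graft ⁻¹' (Set.pi s t) = (if [] ∈ s then t [] else univ) ×ˢ
      Set.pi univ fun j => Set.pi
        (s.preimage (List.cons j) (List.cons_injective.injOn) : Finset (List (Fin 4)))
        fun w => t (j :: w) := by
    ext ⟨φ, τ⟩
    simp only [mem_preimage, Set.mem_pi, mem_prod, Finset.coe_preimage, Finset.mem_coe, mem_univ,
      true_imp_iff]
    constructor
    · intro h
      refine ⟨?_, fun j w hw => h (j :: w) hw⟩
      split_ifs with hs
      · exact h [] hs
      · trivial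
    · rintro ⟨h1, h2⟩ w hw
      cases w with
      | nil => rw [if_pos hw] at h1; exact h1
      | cons j w => exact h2 j w hw
  rw [Measure.map_apply measurable_graft
    (MeasurableSet.pi s.countable_toSet fun i _ => ht i), hpre, Measure.prod_prod, Measure.pi_pi,
    prod_list_eq_prod_nil_mul_prod_cons]
  congr 1
  · split_ifs <;> simp
  · refine Finset.prod_congr rfl fun j _ => ?_
    rw [Measure.infinitePi_pi _ fun w _ => ht (j :: w)]

lemma mem_proj_closedBall (θ x r : ℝ) (c : ℂ) :
    x ∈ proj θ (Metric.closedBall c r) ↔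
      |x - (Complex.exp (-(θ : ℂ) * Complex.I) * c).re| ≤ r := by
  have hnorm : ∀ a : ℝ, ‖Complex.exp ((a : ℂ) * Complex.I)‖ = 1 := Complex.norm_exp_ofReal_mul_I
  constructor
  · rintro ⟨z, hz, rfl⟩
    rw [← Complex.sub_re, ← mul_sub]
    refine (Complex.abs_re_le_norm _).trans ?_
    have := hnorm (-θ)
    rw [Complex.ofReal_neg] at this
    rw [norm_mul, this, one_mul]
    simpa [dist_eq_norm] using hz
  · intro h
    refine ⟨c + ((x - (Complex.exp (-(θ : ℂ) * Complex.I) * c).re : ℝ) : ℂ) *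
      Complex.exp ((θ : ℂ) * Complex.I), ?_, ?_⟩
    · rw [Metric.mem_closedBall, dist_eq_norm, add_sub_cancel_left, norm_mul, hnorm, mul_one,
        Complex.norm_real]
      exact h
    · have : Complex.exp (-(θ : ℂ) * Complex.I) * Complex.exp ((θ : ℂ) * Complex.I) = 1 := by
        rw [← Complex.exp_add]
        simp
      simp only
      rw [mul_add, mul_left_comm, this, mul_one, Complex.add_re, Complex.ofReal_re]
      ring

lemma mem_proj_cantorDisks (θ x : ℝ) (n : ℕ) (ω : InfAngleTree) :
    x ∈ proj θ (cantorDisks n ω) ↔ ∃ w : Fin n → Fin 4,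
      |x - (Complex.exp (-(θ : ℂ) * Complex.I) * center ω w).re| ≤ (4 : ℝ)⁻¹ ^ n := by
  simp only [← mem_proj_closedBall]
  simp only [proj, cantorDisks, image_iUnion, mem_iUnion]

lemma center_graft_cons (p : ℝ × (Fin 4 → InfAngleTree)) {n : ℕ} (j : Fin 4)
    (w : Fin n → Fin 4) :
    center (graft p) (Fin.cons j w : Fin (n + 1) → Fin 4) =
      (3 / 4 : ℂ) * Complex.exp (((((j : ℕ) : ℝ) * (π / 2) - p.1 : ℝ) : ℂ) * Complex.I) +
        4⁻¹ * center (p.2 j) w := by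
  unfold _root_.center
  rw [Fin.sum_univ_succ, Finset.mul_sum]
  congr 1
  · simp [graft]
  · refine Finset.sum_congr rfl fun k _ => ?_
    have h : (List.ofFn fun i : Fin (k.succ : Fin (n + 1)) =>
        (Fin.cons j w : Fin (n + 1) → Fin 4) (Fin.castLE k.succ.isLt.le i)) =
        j :: List.ofFn fun i : Fin k => w (Fin.castLE k.isLt.le i) := by
      exact List.ofFn_succ
    rw [h]
    simp only [Fin.cons_succ, graft, Fin.val_succ, pow_succ]
    ring

lemma re_exp_mul_exp (θ a : ℝ) :
    (Complex.exp (-(θ : ℂ) * Complex.I) * Complex.exp ((a : ℂ) * Complex.I)).re = cos (a - θ) := by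
  rw [← Complex.exp_add, ← Complex.exp_ofReal_mul_I_re]
  congr 2
  push_cast
  ring

lemma mem_proj_cantorDisks_graft (θ x : ℝ) (n : ℕ) (p : ℝ × (Fin 4 → InfAngleTree)) :
    x ∈ proj θ (cantorDisks (n + 1) (graft p)) ↔
      ∃ j, 4 * x - 3 * vertexCoord θ p.1 j ∈ proj θ (cantorDisks n (p.2 j)) := by
  simp only [mem_proj_cantorDisks]
  rw [(Fin.consEquiv fun _ => Fin 4).symm.exists_congr_left, Prod.exists]
  refine exists_congr fun j => exists_congr fun w => ?_
  change |x - (Complex.exp (-(θ : ℂ) * Complex.I) *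
    center (graft p) (Fin.cons j w : Fin (n + 1) → Fin 4)).re| ≤ _ ↔ _
  rw [center_graft_cons, mul_add, mul_left_comm, mul_left_comm _ (4⁻¹ : ℂ), Complex.add_re]
  set e := Complex.exp (-(θ : ℂ) * Complex.I) * center (p.2 j) w
  have h1 : ((3 / 4 : ℂ) * (Complex.exp (-(θ : ℂ) * Complex.I) *
      Complex.exp (((((j : ℕ) : ℝ) * (π / 2) - p.1 : ℝ) : ℂ) * Complex.I))).re =
      3 / 4 * vertexCoord θ p.1 j := by
    rw [vertexCoord, ← re_exp_mul_exp, ← Complex.re_ofReal_mul]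
    push_cast
    rfl
  have h2 : ((4⁻¹ : ℂ) * e).re = 4⁻¹ * e.re := by
    rw [← Complex.re_ofReal_mul]
    push_cast
    rfl
  rw [h1, h2, pow_succ, show 4 * x - 3 * vertexCoord θ p.1 j - e.re =
    4 * (x - (3 / 4 * vertexCoord θ p.1 j + 4⁻¹ * e.re)) by ring, abs_mul,
    abs_of_pos (by norm_num : (0 : ℝ) < 4)]
  constructor <;> intro h <;> linarith

lemma abs_le_one_of_mem_proj_cantorDisks {θ x : ℝ} {n : ℕ} {ω : InfAngleTree}
    (h : x ∈ proj θ (cantorDisks n ω)) : |x| ≤ 1 := by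
  induction n generalizing x ω with
  | zero =>
    rw [mem_proj_cantorDisks] at h
    obtain ⟨w, hw⟩ := h
    simpa [_root_.center] using hw
  | succ n ih =>
    have hω : ω = graft (ω [], fun j w => ω (j :: w)) := by
      ext w
      cases w <;> rfl
    rw [hω, mem_proj_cantorDisks_graft] at h
    obtain ⟨j, hj⟩ := h
    have h1 := abs_le.1 (ih hj)
    have h2 := abs_le.1 (abs_cos_le_one (((j : ℕ) : ℝ) * (π / 2) - ω [] - θ))
    simp only [vertexCoord] at h1
    rw [abs_le]
    constructor <;> linarith

lemma measurable_center {n : ℕ} (w : Fin n → Fin 4) : Measurable fun ω => center ω w := by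
  unfold _root_.center
  fun_prop

lemma measurableSet_mem_proj_cantorDisks (n : ℕ) :
    MeasurableSet {p : (ℝ × ℝ) × InfAngleTree | p.1.2 ∈ proj p.1.1 (cantorDisks n p.2)} := by
  simp only [mem_proj_cantorDisks, ofPred_exists]
  refine MeasurableSet.iUnion fun w => measurableSet_le ?_ measurable_const
  have h := (measurable_center w).comp
    (measurable_snd : Measurable (Prod.snd : (ℝ × ℝ) × InfAngleTree → _))
  simp only [Function.comp_def] at h
  have h2 := Complex.measurable_re.comp
    ((by fun_prop : Measurable fun p : (ℝ × ℝ) × InfAngleTree =>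
      Complex.exp (-((p.1.1 : ℝ) : ℂ) * Complex.I)).mul h)
  simp only [Function.comp_def] at h2
  fun_prop

lemma measure_iUnion_add_measure_inter_le {Ω ι : Type*} [MeasurableSpace Ω] [Fintype ι]
    [DecidableEq ι] (P : Measure Ω) {B : ι → Set Ω} (hB : ∀ i, MeasurableSet (B i)) {i j : ι}
    (hij : i ≠ j) : P (⋃ k, B k) + P (B i ∩ B j) ≤ ∑ k, P (B k) := by
  have hsub : (⋃ k, B k) ⊆ (B i ∪ B j) ∪ ⋃ k ∈ (Finset.univ.erase i).erase j, B k := by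
    intro ω hω
    obtain ⟨k, hk⟩ := mem_iUnion.1 hω
    by_cases h1 : k = i
    · exact Or.inl (Or.inl (h1 ▸ hk))
    · by_cases h2 : k = j
      · exact Or.inl (Or.inr (h2 ▸ hk))
      · exact Or.inr (mem_iUnion₂.2 ⟨k, by simp [h1, h2], hk⟩)
  calc P (⋃ k, B k) + P (B i ∩ B j)
      ≤ (P (B i ∪ B j) + ∑ k ∈ (Finset.univ.erase i).erase j, P (B k)) + P (B i ∩ B j) := by
        gcongr
        exact (measure_mono hsub).trans ((measure_union_le _ _).trans
          (add_le_add le_rfl (measure_biUnion_finset_le _ _)))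
    _ = (P (B i ∪ B j) + P (B i ∩ B j)) + ∑ k ∈ (Finset.univ.erase i).erase j, P (B k) :=
        add_right_comm _ _ _
    _ = ∑ k, P (B k) := by
        rw [measure_union_add_inter _ (hB j), ← Finset.add_sum_erase _ _ (Finset.mem_univ i),
          ← Finset.add_sum_erase _ _ (Finset.mem_erase.2 ⟨hij.symm, Finset.mem_univ j⟩), add_assoc]

lemma pi_eval_inter {Ω : Type*} [MeasurableSpace Ω] (ν : Measure Ω) [IsProbabilityMeasure ν]
    (H : Fin 4 → Set Ω) (j : Fin 4) :
    Measure.pi (fun _ : Fin 4 => ν) ({t | t j ∈ H j} ∩ {t | t (j + 1) ∈ H (j + 1)}) =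
      ν (H j) * ν (H (j + 1)) := by
  have hj : j + 1 ≠ j := by
    revert j
    decide
  have h : ({t : Fin 4 → Ω | t j ∈ H j} ∩ {t | t (j + 1) ∈ H (j + 1)}) =
      Set.pi univ fun k => if k = j then H j else if k = j + 1 then H (j + 1) else univ := by
    ext t
    simp only [mem_inter_iff, mem_ofPred_eq, Set.mem_pi, mem_univ, true_imp_iff]
    constructor
    · rintro ⟨h1, h2⟩ k
      split_ifs with h3 h4
      · exact h3 ▸ h1
      · exact h4 ▸ h2
      · trivial
    · intro h
      refine ⟨by simpa using h j, by simpa [hj] using h (j + 1)⟩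
  rw [h, Measure.pi_pi, ← Finset.mul_prod_erase _ _ (Finset.mem_univ j),
    ← Finset.mul_prod_erase _ _ (Finset.mem_erase.2 ⟨hj, Finset.mem_univ (j + 1)⟩),
    Finset.prod_eq_one, if_pos rfl, if_neg hj, if_pos rfl, mul_one]
  intro k hk
  simp only [Finset.mem_erase] at hk
  simp [hk.1, hk.2.1]

lemma four_mul_pi_iUnion_add_sum_le {Ω : Type*} [MeasurableSpace Ω] (ν : Measure Ω)
    [IsProbabilityMeasure ν] {H : Fin 4 → Set Ω} (hH : ∀ j, MeasurableSet (H j)) :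
    4 * Measure.pi (fun _ : Fin 4 => ν) {t | ∃ j, t j ∈ H j} + ∑ j, ν (H j) * ν (H (j + 1)) ≤
      4 * ∑ j, ν (H j) := by
  have hB : ∀ j, MeasurableSet {t : Fin 4 → Ω | t j ∈ H j} := fun j => measurable_pi_apply j (hH j)
  have hsum : ∑ j : Fin 4, (Measure.pi (fun _ : Fin 4 => ν) {t | ∃ j, t j ∈ H j} +
      ν (H j) * ν (H (j + 1))) ≤ ∑ _j : Fin 4, ∑ k, ν (H k) := by
    refine Finset.sum_le_sum fun j _ => ?_
    have hj : j ≠ j + 1 := by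
      revert j
      decide
    have h := measure_iUnion_add_measure_inter_le (Measure.pi fun _ : Fin 4 => ν) hB hj
    rw [pi_eval_inter, ← ofPred_exists] at h
    refine h.trans (Finset.sum_le_sum fun k _ => le_of_eq ?_)
    exact (measurePreserving_eval (fun _ : Fin 4 => ν) k).measure_preimage
      (hH k).nullMeasurableSet
  simpa [Finset.sum_add_distrib] using hsum

/-- The law of i.i.d. uniform angles indexed by all finite words. -/
def treeMeasure : Measure InfAngleTree := Measure.infinitePi fun _ : List (Fin 4) => unif

instance : IsProbabilityMeasure treeMeasure := by
  unfold treeMeasure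
  infer_instance

/-- The probability that `x` lies in the projection of `𝒟_n` in direction `θ`. -/
def hitProb (n : ℕ) (θ x : ℝ) : ℝ≥0∞ := treeMeasure {ω | x ∈ proj θ (cantorDisks n ω)}

lemma measurable_hitProb_uncurry (n : ℕ) : Measurable fun p : ℝ × ℝ => hitProb n p.1 p.2 :=
  measurable_measure_prodMk_left (measurableSet_mem_proj_cantorDisks n)

lemma measurable_hitProb (n : ℕ) (θ : ℝ) : Measurable (hitProb n θ) :=
  Measurable.of_uncurry_left (f := hitProb n) (measurable_hitProb_uncurry n)

lemma measurableSet_hit (n : ℕ) (θ x : ℝ) :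
    MeasurableSet {ω : InfAngleTree | x ∈ proj θ (cantorDisks n ω)} :=
  (measurable_prodMk_left : Measurable (Prod.mk (θ, x) : InfAngleTree → _))
    (measurableSet_mem_proj_cantorDisks n)

lemma hitProb_eq_zero (n : ℕ) (θ : ℝ) {x : ℝ} (hx : 1 < |x|) : hitProb n θ x = 0 := by
  unfold hitProb
  convert measure_empty (μ := treeMeasure)
  ext ω
  simp only [mem_ofPred_eq, mem_empty_iff_false, iff_false]
  exact fun h => hx.not_ge (abs_le_one_of_mem_proj_cantorDisks h)

lemma lintegral_hitProb_le_two (n : ℕ) (θ : ℝ) : ∫⁻ x, hitProb n θ x ≤ 2 := by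
  calc ∫⁻ x, hitProb n θ x ≤ ∫⁻ x, (Icc (-1 : ℝ) 1).indicator 1 x := by
        refine lintegral_mono fun x => ?_
        by_cases hx : 1 < |x|
        · simp [hitProb_eq_zero n θ hx]
        · have hx' : x ∈ Icc (-1 : ℝ) 1 := abs_le.1 (not_lt.1 hx)
          rw [indicator_of_mem hx']
          exact prob_le_one
    _ = 2 := by
        rw [lintegral_indicator_one measurableSet_Icc, Real.volume_Icc]
        norm_num

lemma hitProb_succ (n : ℕ) (θ x : ℝ) :
    hitProb (n + 1) θ x = ∫⁻ φ, Measure.pi (fun _ : Fin 4 => treeMeasure)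
      {t | ∃ j, t j ∈ {ω | 4 * x - 3 * vertexCoord θ φ j ∈ proj θ (cantorDisks n ω)}} ∂unif := by
  have h : treeMeasure = (unif.prod (Measure.pi fun _ : Fin 4 => treeMeasure)).map graft :=
    map_graft_infinitePi_unif.symm
  rw [hitProb]
  conv_lhs => rw [h]
  rw [Measure.map_apply measurable_graft (measurableSet_hit _ _ _),
    Measure.prod_apply (measurable_graft (measurableSet_hit _ _ _))]
  congr! with φ
  ext t
  exact mem_proj_cantorDisks_graft θ x n (φ, t)

lemma lintegral_hitProb_succ_add_le (n : ℕ) (θ : ℝ) :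
    (∫⁻ x, hitProb (n + 1) θ x) + (∫⁻ x, hitProb n θ x) ^ 2 / 200 ≤ ∫⁻ x, hitProb n θ x := by
  refine lintegral_add_sq_div_le_of_step (measurable_hitProb n θ) (measurable_hitProb (n + 1) θ)
    (fun x hx => hitProb_eq_zero n θ hx) θ fun x => ?_
  have hf := measurable_hitProb n θ
  have hv : ∀ j, Measurable fun φ => vertexCoord θ φ j := by
    intro j
    unfold vertexCoord
    fun_prop
  rw [hitProb_succ, ← lintegral_const_mul' _ _ (by simp), ← lintegral_add_right _ (by fun_prop),
    ← lintegral_const_mul' _ _ (by simp)]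
  exact lintegral_mono fun φ =>
    four_mul_pi_iUnion_add_sum_le treeMeasure fun j => measurableSet_hit _ _ _

lemma natCast_mul_le_of_add_sq_div_le {u : ℕ → ℝ≥0∞} (h0 : u 0 ≤ 2)
    (h : ∀ n, u (n + 1) + u n ^ 2 / 200 ≤ u n) (n : ℕ) : n * u n ≤ 200 := by
  have hle2 : ∀ n, u n ≤ 2 := by
    intro n
    induction n with
    | zero => exact h0
    | succ n ih => exact (le_self_add.trans (h n)).trans ih
  have htop : ∀ n, u n ≠ ⊤ := fun n => ((hle2 n).trans_lt (by simp)).ne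
  have hreal : ∀ n, (u (n + 1)).toReal + (u n).toReal ^ 2 / 200 ≤ (u n).toReal := by
    intro n
    have h1 := ENNReal.toReal_mono (htop n) (h n)
    rw [ENNReal.toReal_add (htop _) (ENNReal.div_ne_top (ENNReal.pow_ne_top (htop n)) (by simp))]
      at h1
    simpa using h1
  have hmain : ∀ n : ℕ, (n + 1) * (u n).toReal ≤ 200 := by
    intro n
    induction n with
    | zero =>
      have := ENNReal.toReal_mono (by simp) h0
      simp at this ⊢
      linarith
    | succ n ih =>
      have h1 := hreal n
      have h2 : (0 : ℝ) ≤ (u n).toReal := ENNReal.toReal_nonneg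
      have h3 : (0 : ℝ) ≤ (u (n + 1)).toReal := ENNReal.toReal_nonneg
      push_cast
      have hn : (0 : ℝ) ≤ n := Nat.cast_nonneg n
      set a := (u n).toReal
      set b := (u (n + 1)).toReal
      by_cases hcase : ((n : ℝ) + 2) * a ≤ 200
      · nlinarith [sq_nonneg a]
      · push Not at hcase
        have h4 : b ≤ a * (1 - a / 200) := by linarith
        have h5 : ((n : ℝ) + 2) * (1 - a / 200) ≤ n + 1 := by linarith
        have h6 : ((n : ℝ) + 2) * b ≤ a * (n + 1) := by
          calc ((n : ℝ) + 2) * b ≤ (n + 2) * (a * (1 - a / 200)) := by gcongr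
            _ = a * ((n + 2) * (1 - a / 200)) := by ring
            _ ≤ a * (n + 1) := by gcongr
        linarith
  rw [← ENNReal.toReal_le_toReal (ENNReal.mul_ne_top (by simp) (htop n)) (by simp)]
  have := hmain n
  have h2 : (0 : ℝ) ≤ (u n).toReal := ENNReal.toReal_nonneg
  simp only [ENNReal.toReal_mul, ENNReal.toReal_natCast, ENNReal.toReal_ofNat]
  linarith

lemma volume_proj_cantorDisks (θ : ℝ) (n : ℕ) (ω : InfAngleTree) :
    volume (proj θ (cantorDisks n ω)) = ∫⁻ x,
      {p : (ℝ × ℝ) × InfAngleTree | p.1.2 ∈ proj p.1.1 (cantorDisks n p.2)}.indicator 1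
        ((θ, x), ω) := by
  rw [← lintegral_indicator_one]
  · rfl
  · exact (by fun_prop : Measurable fun x : ℝ => ((θ, x), ω))
      (measurableSet_mem_proj_cantorDisks n)

lemma measurable_favLength_cantorDisks (n : ℕ) :
    Measurable fun ω : InfAngleTree => favLength (cantorDisks n ω) := by
  unfold favLength
  simp_rw [volume_proj_cantorDisks]
  have h : Measurable ({p : (ℝ × ℝ) × InfAngleTree |
      p.1.2 ∈ proj p.1.1 (cantorDisks n p.2)}.indicator (1 : (ℝ × ℝ) × InfAngleTree → ℝ≥0∞)) :=
    measurable_one.indicator (measurableSet_mem_proj_cantorDisks n)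
  fun_prop

lemma lintegral_favLength_cantorDisks (n : ℕ) :
    ∫⁻ ω, favLength (cantorDisks n ω) ∂treeMeasure =
      ENNReal.ofReal (1 / π) * ∫⁻ θ in Ioo 0 π, ∫⁻ x, hitProb n θ x := by
  have h : Measurable ({p : (ℝ × ℝ) × InfAngleTree |
      p.1.2 ∈ proj p.1.1 (cantorDisks n p.2)}.indicator (1 : (ℝ × ℝ) × InfAngleTree → ℝ≥0∞)) :=
    measurable_one.indicator (measurableSet_mem_proj_cantorDisks n)
  unfold favLength
  rw [lintegral_const_mul' _ _ ENNReal.ofReal_ne_top]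
  simp_rw [volume_proj_cantorDisks]
  rw [lintegral_lintegral_swap (by fun_prop)]
  congr 1
  refine lintegral_congr fun θ => ?_
  rw [lintegral_lintegral_swap (by fun_prop)]
  refine lintegral_congr fun x => ?_
  rw [hitProb, ← lintegral_indicator_one (measurableSet_hit n θ x)]
  rfl

lemma lintegral_natCast_mul_favLength_le (n : ℕ) :
    ∫⁻ ω, n * favLength (cantorDisks n ω) ∂treeMeasure ≤ 200 := by
  rw [lintegral_const_mul' _ _ (by simp), lintegral_favLength_cantorDisks, mul_left_comm,
    ← lintegral_const_mul' _ _ (by simp)]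
  calc ENNReal.ofReal (1 / π) * ∫⁻ θ in Ioo 0 π, n * ∫⁻ x, hitProb n θ x
      ≤ ENNReal.ofReal (1 / π) * ∫⁻ _ in Ioo 0 π, 200 := by
        gcongr with θ
        exact natCast_mul_le_of_add_sq_div_le (u := fun n => ∫⁻ x, hitProb n θ x)
          (lintegral_hitProb_le_two 0 θ) (fun n => lintegral_hitProb_succ_add_le n θ) n
    _ = 200 := by
        rw [setLIntegral_const, Real.volume_Ioo, sub_zero, mul_left_comm,
          ← ENNReal.ofReal_mul (by positivity), one_div_mul_cancel Real.pi_ne_zero]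
        simp

lemma eq_treeMeasure_of_map_restrict {μ : Measure InfAngleTree}
    (hμ : ∀ s : Finset (List (Fin 4)),
      μ.map (fun ω (w : s) => ω w) = Measure.pi fun _ : s => unif) :
    μ = treeMeasure :=
  IsProjectiveLimit.unique (α := fun _ => ℝ)
    (P := fun s : Finset (List (Fin 4)) => Measure.pi fun _ : s => unif)
    hμ (Measure.isProjectiveLimit_infinitePi _)

/-- If the angles `(ω_w)`, indexed by all finite words over `{0,1,2,3}`, are i.i.d.
uniform on `[0, π/2]` (i.e. all finite-dimensional marginals of their joint law `μ` are
products of uniform measures), then `μ`-almost surely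
`liminf_{n → ∞} n · Fav(𝒟_n(ω)) < ∞`. -/
theorem liminf_n_mul_favard_lt_top (μ : Measure InfAngleTree)
    [IsProbabilityMeasure μ]
    (hμ : ∀ s : Finset (List (Fin 4)),
      μ.map (fun ω (w : s) => ω w) = Measure.pi fun _ : s => unif) :
    ∀ᵐ ω ∂μ,
      Filter.liminf (fun n : ℕ => (n : ℝ≥0∞) * favLength (cantorDisks n ω))
        Filter.atTop < ⊤ := by
  obtain rfl := eq_treeMeasure_of_map_restrict hμ
  have hmeas : ∀ n : ℕ, Measurable fun ω : InfAngleTree =>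
      (n : ℝ≥0∞) * favLength (cantorDisks n ω) := fun n =>
    (measurable_favLength_cantorDisks n).const_mul _
  refine ae_lt_top (.liminf hmeas) (ne_top_of_le_ne_top (b := 200) (by simp) ?_)
  refine (lintegral_liminf_le hmeas).trans ?_
  refine (Filter.liminf_le_liminf
    (Filter.Eventually.of_forall lintegral_natCast_mul_favLength_le)).trans ?_
  simp

end
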